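/- Let R be a Cohen-Macaulay local ring with canonical module ω, and for an R-module M write M^∨ = Hom_R(M, ω). Then for any maximal Cohen-Macaulay R-modules M, N and all i ≥ 0, there is an isomorphism Ext_R^i(M, N) ≅ Ext_R^i(N^∨, M^∨). -/

import Mathlib

open CategoryTheory Opposite IsLocalRing

noncomputable abbrev ExtGroup (R : Type) [CommRing R] (i : ℕ)
    (M N : Type) [AddCommGroup M] [Module R M] [AddCommGroup N] [Module R N] : Type :=
  ((Ext R (ModuleCat R) i).obj (op (ModuleCat.of R M))).obj (ModuleCat.of R N)

/-- The depth of a module over a local ring, via vanishing of `Ext^i(k, M)`. -/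
noncomputable def moduleDepth (R : Type) [CommRing R] [IsLocalRing R]
    (M : Type) [AddCommGroup M] [Module R M] : ℕ∞ :=
  sInf {i : ℕ∞ | ∃ n : ℕ, i = n ∧ Nontrivial (ExtGroup R n (ResidueField R) M)}

/-- A local ring is Cohen-Macaulay if its depth equals its Krull dimension. -/
def IsCohenMacaulayLocalRing (R : Type) [CommRing R] [IsLocalRing R] : Prop :=
  IsNoetherianRing R ∧ ((moduleDepth R R : ℕ∞) : WithBot ℕ∞) = ringKrullDim R

/-- A maximal Cohen-Macaulay module: a finitely generated module whose depth equals the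
Krull dimension of the (local) base ring. -/
def IsMCM (R : Type) [CommRing R] [IsLocalRing R]
    (M : Type) [AddCommGroup M] [Module R M] : Prop :=
  Module.Finite R M ∧ ((moduleDepth R M : ℕ∞) : WithBot ℕ∞) = ringKrullDim R

/-- `ω` is a canonical (dualizing) module for the Cohen-Macaulay local ring `R`:
it is finitely generated, and `Ext^i(k, ω)` vanishes for `i ≠ dim R` while being
one-dimensional (isomorphic to `k`) for `i = dim R`. -/
def IsCanonicalModule (R : Type) [CommRing R] [IsLocalRing R]
    (ω : Type) [AddCommGroup ω] [Module R ω] : Prop :=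
  Module.Finite R ω ∧
    (∀ i : ℕ, ((i : ℕ∞) : WithBot ℕ∞) ≠ ringKrullDim R →
      Subsingleton (ExtGroup R i (ResidueField R) ω)) ∧
    (∀ i : ℕ, ((i : ℕ∞) : WithBot ℕ∞) = ringKrullDim R →
      Nonempty (ExtGroup R i (ResidueField R) ω ≃ₗ[R] ResidueField R))

open CategoryTheory Opposite IsLocalRing

theorem homology_lequiv {R : Type} [CommRing R] (S : ShortComplex (ModuleCat.{0} R)) {E : Type} [AddCommGroup E]
    [Module R E] (φ : LinearMap.ker S.g.hom →ₗ[R] E) (h1 : Function.Surjective φ)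
    (h2 : ∀ z : LinearMap.ker S.g.hom, φ z = 0 ↔ ∃ y, S.f.hom y = z) :
    Nonempty (S.homology ≃ₗ[R] E) := by
  have hk : LinearMap.range S.moduleCatToCycles = LinearMap.ker φ := by
    ext z
    rw [LinearMap.mem_ker, h2, LinearMap.mem_range]
    simp only [Subtype.ext_iff]
    rfl
  exact ⟨S.moduleCatHomologyIso.toLinearEquiv ≪≫ₗ (Submodule.quotEquivOfEq _ _ hk) ≪≫ₗ
    φ.quotKerEquivOfSurjective h1⟩

theorem extMk_zero_aux {R : Type} [CommRing R] {X Y : ModuleCat.{0} R} (P : ProjectiveResolution X)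
    (f : P.complex.X 0 ⟶ Y) (hf : P.complex.d 1 0 ≫ f = 0)
    (h : P.extMk (n := 0) f 1 rfl hf = (0 : Abelian.Ext.{0} X Y 0)) : f = 0 := by
  rw [← P.extEquivCohomologyClass.apply_eq_iff_eq] at h
  simp only [
    ProjectiveResolution.extEquivCohomologyClass_extMk,
    ProjectiveResolution.extEquivCohomologyClass_zero,
    CochainComplex.HomComplex.CohomologyClass.mk_eq_zero_iff] at h
  rw [CochainComplex.HomComplex.Cocycle.toSingleMk_mem_coboundaries_iff _ _ _ _ _ 1 (by lia)] at h
  obtain ⟨g, hg⟩ := h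
  have hz : Limits.IsZero (P.cochainComplex.X 1) := by
    exact P.cochainComplex.isZero_of_isStrictlyLE 0 1
  rw [hz.eq_of_src g 0, Limits.comp_zero] at hg
  exact ((cancel_epi _).1 (hg.symm.trans Limits.comp_zero.symm))

theorem ext_comparison {R : Type} [CommRing R] (X Y : ModuleCat.{0} R) (n : ℕ) :
    Nonempty (((Ext R (ModuleCat R) n).obj (op X)).obj Y ≃ₗ[R] Abelian.Ext.{0} X Y n) := by
  let P := projectiveResolution X
  let K := P.complex.linearYonedaObj R Y
  have hn : (ComplexShape.up ℕ).next n = n + 1 := CochainComplex.next ℕ n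
  have hc : ∀ z : LinearMap.ker (K.sc n).g.hom, P.complex.d (n+1) n ≫ (show P.complex.X n ⟶ Y from z.1) = 0 := by
    intro z
    have := z.2
    rw [LinearMap.mem_ker] at this
    rw [← hn]
    exact this
  let φ : LinearMap.ker (K.sc n).g.hom →ₗ[R] Abelian.Ext.{0} X Y n :=
    { toFun := fun z => P.extMk (show P.complex.X n ⟶ Y from z.1) (n+1) rfl (hc z)
      map_add' := fun z w => (P.add_extMk _ _ (n+1) rfl (hc z) (hc w)).symm
      map_smul' := fun r z => by
        rw [RingHom.id_apply, Abelian.Ext.smul_eq_comp_mk₀, P.extMk_comp_mk₀]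
        congr 1 }
  obtain ⟨e⟩ := homology_lequiv (K.sc n) φ (by
    intro α
    obtain ⟨f, hf, rfl⟩ := P.extMk_surjective α (n+1) rfl
    refine ⟨⟨f, ?_⟩, rfl⟩
    change (K.sc n).g.hom f = 0
    rw [← hn] at hf
    exact hf) (by
    intro z
    cases n with
    | zero =>
      have hp : (ComplexShape.up ℕ).prev 0 = 0 := by simp
      have hf0 : (K.sc 0).f = 0 := K.shape _ _ (by simp [hp])
      constructor
      · intro h
        refine ⟨0, ?_⟩
        rw [map_zero]
        exact (extMk_zero_aux P _ (hc z) h).symm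
      · rintro ⟨y, hy⟩
        rw [hf0] at hy
        have : z = 0 := Subtype.ext hy.symm
        rw [this, map_zero]
    | succ p =>
      have hp : (ComplexShape.up ℕ).prev (p+1) = p := CochainComplex.prev_nat_succ p
      refine (P.extMk_eq_zero_iff _ (p+1+1) rfl (hc z) p rfl).trans ?_
      have key : ∀ q, (ComplexShape.up ℕ).prev (p+1) = q →
          ((∃ g : P.complex.X q ⟶ Y, P.complex.d (p+1) q ≫ g = (show P.complex.X (p+1) ⟶ Y from z.1)) ↔
            z.1 ∈ LinearMap.range (K.sc (p+1)).f.hom) := by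
        rintro q rfl
        exact Iff.rfl
      exact key p hp)
  exact ⟨(P.isoExt n Y).toLinearEquiv ≪≫ₗ e⟩

open CategoryTheory Opposite IsLocalRing

section LES
open Abelian
variable {R : Type} [CommRing R]

theorem sub_cov1 {S : ShortComplex (ModuleCat.{0} R)} (hS : S.ShortExact) (X : ModuleCat.{0} R) (i : ℕ)
    (h3 : Subsingleton (Ext.{0} X S.X₃ i)) (h2 : Subsingleton (Ext.{0} X S.X₂ (i+1))) :
    Subsingleton (Ext.{0} X S.X₁ (i+1)) := by
  refine subsingleton_of_forall_eq 0 fun e => ?_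
  obtain ⟨y, rfl⟩ := Ext.covariant_sequence_exact₁ X hS e (Subsingleton.elim _ _) rfl
  rw [Subsingleton.elim y 0, Ext.zero_comp]

theorem sub_cov3 {S : ShortComplex (ModuleCat.{0} R)} (hS : S.ShortExact) (X : ModuleCat.{0} R) (i : ℕ)
    (h2 : Subsingleton (Ext.{0} X S.X₂ i)) (h1 : Subsingleton (Ext.{0} X S.X₁ (i+1))) :
    Subsingleton (Ext.{0} X S.X₃ i) := by
  refine subsingleton_of_forall_eq 0 fun e => ?_
  obtain ⟨y, rfl⟩ := Ext.covariant_sequence_exact₃ X hS e rfl (Subsingleton.elim _ _)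
  rw [Subsingleton.elim y 0, Ext.zero_comp]

theorem sub_con1 {S : ShortComplex (ModuleCat.{0} R)} (hS : S.ShortExact) (Y : ModuleCat.{0} R) (i : ℕ)
    (h2 : Subsingleton (Ext.{0} S.X₂ Y i)) (h3 : Subsingleton (Ext.{0} S.X₃ Y (i+1))) :
    Subsingleton (Ext.{0} S.X₁ Y i) := by
  refine subsingleton_of_forall_eq 0 fun e => ?_
  obtain ⟨y, rfl⟩ := Ext.contravariant_sequence_exact₁ hS Y e (add_comm 1 i) (Subsingleton.elim _ _)
  rw [Subsingleton.elim y 0, Ext.comp_zero]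

theorem sub_con2 {S : ShortComplex (ModuleCat.{0} R)} (hS : S.ShortExact) (Y : ModuleCat.{0} R) (i : ℕ)
    (h1 : Subsingleton (Ext.{0} S.X₁ Y i)) (h3 : Subsingleton (Ext.{0} S.X₃ Y i)) :
    Subsingleton (Ext.{0} S.X₂ Y i) := by
  refine subsingleton_of_forall_eq 0 fun e => ?_
  obtain ⟨y, rfl⟩ := Ext.contravariant_sequence_exact₂ hS Y e (Subsingleton.elim _ _)
  rw [Subsingleton.elim y 0, Ext.comp_zero]

theorem ext_sub_of_iso {X X' : ModuleCat.{0} R} (f : X ≅ X') (Y : ModuleCat.{0} R) (i : ℕ)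
    (h : Subsingleton (Ext.{0} X' Y i)) : Subsingleton (Ext.{0} X Y i) := by
  refine subsingleton_of_forall_eq 0 fun e => ?_
  have : e = (Ext.mk₀ f.hom).comp ((Ext.mk₀ f.inv).comp e (zero_add _)) (zero_add _) := by
    rw [← Ext.comp_assoc_of_second_deg_zero, Ext.mk₀_comp_mk₀, f.hom_inv_id, Ext.mk₀_id_comp]
  rw [this, Subsingleton.elim ((Ext.mk₀ f.inv).comp e (zero_add _)) 0, Ext.comp_zero]

theorem ext_smul_pre {X Y : ModuleCat.{0} R} {i : ℕ} (r : R) (e : Ext.{0} X Y i) :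
    r • e = (Ext.mk₀ (r • 𝟙 X)).comp e (zero_add i) := by
  simp [Ext.mk₀_smul]

theorem ext_smul_post {X Y : ModuleCat.{0} R} {i : ℕ} (r : R) (e : Ext.{0} X Y i) :
    r • e = e.comp (Ext.mk₀ (r • 𝟙 Y)) (add_zero i) := by
  simp [Ext.mk₀_smul]

theorem exists_syzygy [IsNoetherianRing R] (M : ModuleCat.{0} R) [Module.Finite R M] :
    ∃ (n : ℕ) (K : ModuleCat.{0} R) (f : K ⟶ ModuleCat.of R (Fin n → R))
      (g : ModuleCat.of R (Fin n → R) ⟶ M) (w : f ≫ g = 0),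
      (ShortComplex.mk f g w).ShortExact ∧ Module.Finite R K := by
  obtain ⟨n, g, hg⟩ := Module.Finite.exists_fin' R M
  refine ⟨n, ModuleCat.of R (LinearMap.ker g), ModuleCat.ofHom (LinearMap.ker g).subtype,
    ModuleCat.ofHom g, by ext x; exact x.2, ?_, ?_⟩
  · exact LinearMap.shortExact_shortComplexKer hg
  · change Module.Finite R (LinearMap.ker g)
    infer_instance

instance proj_fin (n : ℕ) : Projective (ModuleCat.of R (Fin n → R)) :=
  (IsProjective.iff_projective _).1 inferInstance

theorem ext_finite [IsNoetherianRing R] (M N : ModuleCat.{0} R) [Module.Finite R M] [Module.Finite R N] (i : ℕ) :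
    Module.Finite R (Ext.{0} M N i) := by
  induction i generalizing M with
  | zero =>
    have : Module.Finite R (M →ₗ[R] N) := inferInstance
    exact Module.Finite.equiv ((Ext.linearEquiv₀ (R := R) (X := M) (Y := N)).trans
      (ModuleCat.homLinearEquiv (S := R))).symm
  | succ i ih =>
    obtain ⟨n, K, f, g, w, hS, hK⟩ := exists_syzygy M
    have := ih K
    refine Module.Finite.of_surjective (hS.extClass.precompOfLinear R N (add_comm 1 i)) ?_
    haveI : Projective (ShortComplex.mk f g w).X₂ := proj_fin n
    exact precomp_extClass_surjective_of_projective_X₂ N hS i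

variable [IsLocalRing R]

theorem sub_of_smul_surj {E : Type} [AddCommGroup E] [Module R E] [Module.Finite R E] {x : R}
    (hx : x ∈ maximalIdeal R) (h : ∀ e : E, ∃ e' : E, x • e' = e) : Subsingleton E := by
  have : (⊤ : Submodule R E) = ⊥ := by
    refine Submodule.eq_bot_of_le_smul_of_le_jacobson_bot (maximalIdeal R) ⊤ (Module.Finite.fg_top) ?_
      (IsLocalRing.maximalIdeal_le_jacobson _)
    intro e _
    obtain ⟨e', rfl⟩ := h e
    exact Submodule.smul_mem_smul hx trivial
  exact (Submodule.subsingleton_iff R).1 (subsingleton_of_bot_eq_top this.symm)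

variable [IsNoetherianRing R]

theorem vanish_of_quot (M W : ModuleCat.{0} R) [Module.Finite R M] [Module.Finite R W] {x : R}
    (hx : x ∈ maximalIdeal R) (hr : IsSMulRegular M x) (i : ℕ)
    (h : Subsingleton (Ext.{0} (ModuleCat.of R (QuotSMulTop x M)) W (i+1))) :
    Subsingleton (Ext.{0} M W i) := by
  have := ext_finite M W i
  refine sub_of_smul_surj hx fun e => ?_
  obtain ⟨e', h'⟩ := Ext.contravariant_sequence_exact₁ hr.smulShortComplex_shortExact W e (add_comm 1 i)
    (h.elim _ _)
  exact ⟨e', (ext_smul_pre (X := M) x e').trans h'⟩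

theorem top_vanish_aux (W : ModuleCat.{0} R) [Module.Finite R W] (d : ℕ)
    (hk : ∀ i, d < i → Subsingleton (Ext.{0} (ModuleCat.of R (ResidueField R)) W i)) (I : Ideal R) :
    ∀ (M : Type) [AddCommGroup M] [Module R M] (_ : Module.Finite R M), I ≤ Module.annihilator R M →
      ∀ i, d < i → Subsingleton (Ext.{0} (ModuleCat.of R M) W i) := by
  induction I using WellFoundedGT.induction with
  | ind I ih =>
  intro M _ _ hM
  refine IsNoetherianRing.induction_on_isQuotientEquivQuotientPrime R hM
    (motive := fun N _ _ _ => I ≤ Module.annihilator R N →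
      ∀ i, d < i → Subsingleton (Ext.{0} (ModuleCat.of R N) W i)) ?_ ?_ ?_
  · intro N _ _ _ _ _ i _
    refine subsingleton_of_forall_eq 0 fun e => ?_
    rw [← Ext.mk₀_id_comp e, show 𝟙 (ModuleCat.of R N) = 0 from by ext x; exact Subsingleton.elim _ _,
      Ext.mk₀_zero, Ext.zero_comp]
  · intro N _ _ _ p e hI i hi
    have hIp : I ≤ p.1 := by
      rw [e.annihilator_eq, Ideal.annihilator_quotient] at hI
      exact hI
    by_cases hp : p.1 = maximalIdeal R
    · rw [hp] at e
      exact ext_sub_of_iso e.toModuleIso W i (hk i hi)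
    · obtain ⟨x, hx, hxp⟩ : ∃ x ∈ maximalIdeal R, x ∉ p.1 := by
        by_contra! hcon
        exact hp (le_antisymm (le_maximalIdeal p.2.ne_top) hcon)
      have hr : IsSMulRegular N x := by
        intro a b hab
        have h1 : x • (e (a - b)) = 0 := by
          rw [← map_smul, smul_sub]
          simp only at hab
          rw [hab, sub_self, map_zero]
        obtain ⟨y, hy⟩ := Ideal.Quotient.mk_surjective (e (a - b))
        rw [← hy] at h1
        have h2 : x * y ∈ p.1 := by
          rw [← Ideal.Quotient.eq_zero_iff_mem]
          exact h1
        have h3 : y ∈ p.1 := (p.2.mem_or_mem h2).resolve_left hxp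
        rw [Ideal.Quotient.eq_zero_iff_mem.2 h3] at hy
        exact sub_eq_zero.1 (e.map_eq_zero_iff.1 hy.symm)
      refine vanish_of_quot (ModuleCat.of R N) W hx hr i ?_
      refine ih (I ⊔ Ideal.span {x}) ?_ (QuotSMulTop x N) inferInstance ?_ (i+1) (by omega)
      · refine lt_of_le_of_ne le_sup_left fun h => hxp (hIp ?_)
        rw [h]
        exact Ideal.mem_sup_right (Ideal.mem_span_singleton_self x)
      · refine sup_le ?_ ?_
        · refine hI.trans ?_
          exact LinearMap.annihilator_le_of_surjective (Submodule.mkQ _) (Submodule.mkQ_surjective _)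
        · rw [Ideal.span_singleton_le_iff_mem, Module.mem_annihilator]
          intro m
          obtain ⟨m, rfl⟩ := Submodule.mkQ_surjective _ m
          rw [← map_smul]
          simp only [Submodule.mkQ_apply, Submodule.Quotient.mk_eq_zero]
          exact Submodule.smul_mem_pointwise_smul m x ⊤ trivial
  · intro N₁ _ _ _ N₂ _ _ _ N₃ _ _ _ f g hf hg hfg h1 h3 hI i hi
    have hS : (ShortComplex.mk (ModuleCat.ofHom f) (ModuleCat.ofHom g)
        (by ext x; exact hfg.apply_apply_eq_zero x)).ShortExact := by
      refine ShortComplex.ShortExact.mk' ?_ ?_ ?_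
      · exact ModuleCat.shortComplex_exact _ hfg
      · exact (ModuleCat.mono_iff_injective _).2 hf
      · exact (ModuleCat.epi_iff_surjective _).2 hg
    exact sub_con2 hS W i (h1 (hI.trans (LinearMap.annihilator_le_of_injective f hf)) i hi)
      (h3 (hI.trans (LinearMap.annihilator_le_of_surjective g hg)) i hi)

theorem top_vanish (W : ModuleCat.{0} R) [Module.Finite R W] (d : ℕ)
    (hk : ∀ i, d < i → Subsingleton (Ext.{0} (ModuleCat.of R (ResidueField R)) W i))
    (M : ModuleCat.{0} R) [hM : Module.Finite R M] (i : ℕ) (hi : d < i) : Subsingleton (Ext.{0} M W i) :=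
  top_vanish_aux W d hk ⊥ M hM bot_le i hi

/-- `depth N ≥ t`. -/
def DepthGE (t : ℕ) (N : ModuleCat.{0} R) : Prop :=
  ∀ j, j < t → Subsingleton (Ext.{0} (ModuleCat.of R (ResidueField R)) N j)

theorem DepthGE.exists_regular {t : ℕ} {N : ModuleCat.{0} R} [Module.Finite R N] (h : DepthGE (t+1) N) :
    ∃ x ∈ maximalIdeal R, IsSMulRegular N x := by
  have h0 := h 0 (by omega)
  have : Subsingleton ((ModuleCat.of R (ResidueField R)) ⟶ N) := Ext.addEquiv₀.subsingleton_congr.mp h0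
  have : Subsingleton (ResidueField R →ₗ[R] N) :=
    (ModuleCat.homAddEquiv (M := ModuleCat.of R (ResidueField R)) (N := N)).symm.subsingleton
  obtain ⟨x, hx, hr⟩ := IsSMulRegular.subsingleton_linearMap_iff.mp this
  refine ⟨x, ?_, hr⟩
  have : Module.annihilator R (ResidueField R) = maximalIdeal R := Ideal.annihilator_quotient
  rwa [this] at hx

theorem DepthGE.quot {t : ℕ} {N : ModuleCat.{0} R} (h : DepthGE (t+1) N) {x : R} (hr : IsSMulRegular N x) :
    DepthGE t (ModuleCat.of R (QuotSMulTop x N)) := fun j hj =>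
  sub_cov3 hr.smulShortComplex_shortExact _ j (h j (by omega)) (h (j+1) (by omega))

theorem ischebeck (W : ModuleCat.{0} R) [Module.Finite R W] (d : ℕ)
    (hk : ∀ i, d < i → Subsingleton (Ext.{0} (ModuleCat.of R (ResidueField R)) W i)) (t : ℕ)
    (M : ModuleCat.{0} R) [hM : Module.Finite R M] (hd : DepthGE t M) (i : ℕ) (hi : d < i + t) :
    Subsingleton (Ext.{0} M W i) := by
  induction t generalizing M i with
  | zero => exact top_vanish W d hk M i hi
  | succ t ih =>
    obtain ⟨x, hx, hr⟩ := hd.exists_regular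
    exact vanish_of_quot M W hx hr i (ih (ModuleCat.of R (QuotSMulTop x M)) (hM := inferInstanceAs (Module.Finite R (QuotSMulTop x M))) (hd.quot hr) (i+1) (by omega))
end LES

open CategoryTheory Opposite IsLocalRing

section Dual
open Abelian
variable {R : Type} [CommRing R] (W : ModuleCat.{0} R)

/-- The dual `Hom(M, W)`. -/
abbrev DD (M : ModuleCat.{0} R) : ModuleCat.{0} R := ModuleCat.of R (M →ₗ[R] W)

/-- The dual of a morphism. -/
abbrev DM {M N : ModuleCat.{0} R} (f : M ⟶ N) : DD W N ⟶ DD W M :=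
  ModuleCat.ofHom (LinearMap.lcomp R W f.hom)

/-- Evaluation at an element. -/
abbrev evm {M : ModuleCat.{0} R} (y : M) : DD W M ⟶ W :=
  ModuleCat.ofHom (LinearMap.applyₗ y)

/-- The biduality map. -/
abbrev theta (M : ModuleCat.{0} R) : M ⟶ DD W (DD W M) :=
  ModuleCat.ofHom (LinearMap.applyₗ)

/-- Acyclicity. -/
def GG (M : ModuleCat.{0} R) : Prop := ∀ i, 0 < i → Subsingleton (Ext.{0} M W i)

theorem dual_w {S : ShortComplex (ModuleCat.{0} R)} : DM W S.g ≫ DM W S.f = 0 := by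
  refine ModuleCat.hom_ext (LinearMap.ext fun (φ : S.X₃ →ₗ[R] W) => LinearMap.ext fun (x : S.X₁) => ?_)
  change φ (S.g.hom (S.f.hom x)) = 0
  have : S.g.hom (S.f.hom x) = 0 := by
    rw [← LinearMap.comp_apply, ← ModuleCat.hom_comp, S.zero]; rfl
  rw [this, map_zero]

theorem dual_shortExact {S : ShortComplex (ModuleCat.{0} R)} (hS : S.ShortExact)
    (h : Subsingleton (Ext.{0} S.X₃ W 1)) :
    (ShortComplex.mk (DM W S.g) (DM W S.f) (dual_w W)).ShortExact := by
  have := hS.epi_g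
  refine ShortComplex.ShortExact.mk' ?_ ?_ ?_
  · refine ModuleCat.shortComplex_exact _ ?_
    refine (LinearMap.exact_iff.2 (le_antisymm ?_ ?_))
    · intro φ hφ
      have h0 : S.f ≫ ModuleCat.ofHom φ = 0 := by
        ext x; exact LinearMap.congr_fun (LinearMap.mem_ker.1 hφ) x
      refine ⟨(hS.exact.desc (ModuleCat.ofHom φ) h0).hom, ?_⟩
      have := hS.exact.g_desc (ModuleCat.ofHom φ) h0
      exact congrArg ModuleCat.Hom.hom this
    · rintro _ ⟨φ, rfl⟩
      rw [LinearMap.mem_ker]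
      exact LinearMap.congr_fun (congrArg ModuleCat.Hom.hom (dual_w W (S := S))) φ
  · refine (ModuleCat.mono_iff_injective _).2 ?_
    intro a b hab
    refine LinearMap.ext fun x => ?_
    obtain ⟨x, rfl⟩ := (ModuleCat.epi_iff_surjective S.g).1 this x
    exact LinearMap.congr_fun hab x
  · refine (ModuleCat.epi_iff_surjective _).2 ?_
    intro φ
    obtain ⟨y, hy⟩ := Ext.contravariant_sequence_exact₁ hS W (Ext.mk₀ (ModuleCat.ofHom φ)) (add_zero 1)
      (Subsingleton.elim _ _)
    obtain ⟨y, rfl⟩ := (Ext.mk₀_bijective _ _).2 y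
    rw [Ext.mk₀_comp_mk₀] at hy
    have := (Ext.mk₀_bijective _ _).1 hy
    exact ⟨y.hom, congrArg ModuleCat.Hom.hom this⟩

theorem ev_lemma {n : ℕ} {X : ModuleCat.{0} R} {j : ℕ} (e : Ext.{0} X (DD W (ModuleCat.of R (Fin n → R))) j)
    (h : ∀ i : Fin n, e.comp (Ext.mk₀ (evm W (M := ModuleCat.of R (Fin n → R)) (Pi.single i 1))) (add_zero j) = 0) :
    e = 0 := by
  let inc : Fin n → (W ⟶ DD W (ModuleCat.of R (Fin n → R))) := fun i =>
    ModuleCat.ofHom (LinearMap.smulRightₗ (LinearMap.proj (R := R) (φ := fun _ : Fin n => R) i))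
  have hid : 𝟙 (DD W (ModuleCat.of R (Fin n → R))) =
      ∑ i, evm W (M := ModuleCat.of R (Fin n → R)) (Pi.single i 1) ≫ inc i := by
    refine ModuleCat.hom_ext (LinearMap.ext fun (φ : (Fin n → R) →ₗ[R] W) => LinearMap.ext fun (v : Fin n → R) => ?_)
    rw [ModuleCat.hom_sum, LinearMap.sum_apply]
    erw [LinearMap.sum_apply]
    change φ v = ∑ i, v i • φ (Pi.single i 1)
    exact LinearMap.pi_apply_eq_sum_univ φ v |>.trans (by
      refine Finset.sum_congr rfl fun i _ => ?_
      congr 2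
      ext j
      simp [Pi.single_apply, eq_comm])
  rw [← Ext.comp_mk₀_id e, hid, Ext.mk₀_sum, Ext.comp_sum]
  refine Finset.sum_eq_zero fun i _ => ?_
  rw [← Ext.mk₀_comp_mk₀, ← Ext.comp_assoc_of_third_deg_zero, h, Ext.zero_comp]

theorem sub_fdual {n : ℕ} {X : ModuleCat.{0} R} {j : ℕ} (h : Subsingleton (Ext.{0} X W j)) :
    Subsingleton (Ext.{0} X (DD W (ModuleCat.of R (Fin n → R))) j) :=
  subsingleton_of_forall_eq 0 fun e => ev_lemma W e fun _ => Subsingleton.elim _ _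

theorem sub_proj {X Y : ModuleCat.{0} R} [Projective X] (i : ℕ) (hi : 0 < i) : Subsingleton (Ext.{0} X Y i) := by
  obtain ⟨i, rfl⟩ := Nat.exists_eq_succ_of_ne_zero hi.ne'
  exact subsingleton_of_forall_eq 0 fun e => Ext.eq_zero_of_projective e

theorem GG.syz {W} {S : ShortComplex (ModuleCat.{0} R)} (hS : S.ShortExact) [Projective S.X₂] (h : GG W S.X₃) :
    GG W S.X₁ := fun i hi => sub_con1 hS W i (sub_proj i hi) (h _ (by omega))

theorem DM_ev {M N : ModuleCat.{0} R} (f : M ⟶ N) (y : M) : DM W f ≫ evm W y = evm W (f.hom y) := rfl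

theorem theta_ev {N : ModuleCat.{0} R} (φ : N →ₗ[R] W) :
    theta W N ≫ evm W (M := DD W N) φ = ModuleCat.ofHom φ := rfl

variable [IsNoetherianRing R]

theorem dual_detect {X : ModuleCat.{0} R} {d : ℕ} (hk : ∀ i, i < d → Subsingleton (Ext.{0} X W i))
    (j : ℕ) (hj : j ≤ d) (Y : ModuleCat.{0} R) [Module.Finite R Y] (hY : GG W Y) (e : Ext.{0} X (DD W Y) j)
    (h : ∀ y : Y, e.comp (Ext.mk₀ (evm W y)) (add_zero j) = 0) : e = 0 := by
  induction j generalizing Y with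
  | zero =>
    obtain ⟨e, rfl⟩ := (Ext.mk₀_bijective _ _).2 e
    suffices e = 0 by rw [this, Ext.mk₀_zero]
    refine ModuleCat.hom_ext (LinearMap.ext fun x => LinearMap.ext fun (y : Y) => ?_)
    have := h y
    rw [Ext.mk₀_comp_mk₀, Ext.mk₀_eq_zero_iff] at this
    exact LinearMap.congr_fun (congrArg ModuleCat.Hom.hom this) x
  | succ j ih =>
    obtain ⟨n, K, f, g, w, hS, hK⟩ := exists_syzygy Y
    have : Projective (ShortComplex.mk f g w).X₂ := proj_fin n
    have hD := dual_shortExact W hS (hY 1 one_pos)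
    obtain ⟨y, rfl⟩ := Ext.covariant_sequence_exact₁ X hD e (by
      refine ev_lemma W _ fun i => ?_
      have h1 := h (g.hom (Pi.single i 1))
      rw [← DM_ev, ← Ext.mk₀_comp_mk₀, ← Ext.comp_assoc_of_third_deg_zero] at h1
      exact h1) rfl
    have := hk j hj
    rw [ih (by omega) K (GG.syz hS hY) y fun _ => Subsingleton.elim _ _, Ext.zero_comp]

theorem GG.depth {W} [IsLocalRing R] {d : ℕ}
    (hk : ∀ i, i < d → Subsingleton (Ext.{0} (ModuleCat.of R (ResidueField R)) W i))
    (Y : ModuleCat.{0} R) [Module.Finite R Y] (hY : GG W Y) : DepthGE d (DD W Y) := fun j hj =>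
  subsingleton_of_forall_eq 0 fun e => dual_detect W hk j hj.le Y hY e fun _ => (hk j hj).elim _ _

instance DD_fin [Module.Finite R W] (M : ModuleCat.{0} R) [Module.Finite R M] : Module.Finite R (DD W M) :=
  inferInstanceAs (Module.Finite R (M →ₗ[R] W))
end Dual

open CategoryTheory Opposite IsLocalRing

section Detect
open Abelian
variable {R : Type} [CommRing R]

theorem ses_of_inj {X Y : ModuleCat.{0} R} (f : X ⟶ Y) (hf : Function.Injective f.hom) :
    (ShortComplex.mk f (ModuleCat.ofHom (LinearMap.range f.hom).mkQ : Y ⟶ ModuleCat.of R (Y ⧸ LinearMap.range f.hom))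
      (by ext x; exact (Submodule.Quotient.mk_eq_zero _).2 ⟨x, rfl⟩)).ShortExact := by
  refine ShortComplex.ShortExact.mk' ?_ ?_ ?_
  · refine ModuleCat.shortComplex_exact _ ?_
    exact LinearMap.exact_map_mkQ_range f.hom
  · exact (ModuleCat.mono_iff_injective _).2 hf
  · exact (ModuleCat.epi_iff_surjective _).2 (Submodule.mkQ_surjective _)

theorem reg_ses {N : ModuleCat.{0} R} {x : R} (hr : IsSMulRegular N x) :
    (ShortComplex.mk (x • 𝟙 N) (ModuleCat.ofHom (Submodule.mkQ _) : N ⟶ ModuleCat.of R (QuotSMulTop x N))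
      (N.smulShortComplex x).zero).ShortExact := hr.smulShortComplex_shortExact

variable [IsLocalRing R]

variable (R) in
/-- The residue field. -/
noncomputable abbrev kap : ModuleCat.{0} R := ModuleCat.of R (ResidueField R)

theorem kap_smul {x : R} (hx : x ∈ maximalIdeal R) (a : kap R) : x • a = 0 := by
  obtain ⟨y, rfl⟩ := Ideal.Quotient.mk_surjective (I := maximalIdeal R) a
  change Ideal.Quotient.mk (maximalIdeal R) (x * y) = 0
  exact Ideal.Quotient.eq_zero_iff_mem.2 (Ideal.mul_mem_right _ _ hx)

theorem kap_inj {N : ModuleCat.{0} R} (f : kap R ⟶ N) (hf : f ≠ 0) : Function.Injective f.hom := by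
  rw [← LinearMap.ker_eq_bot, LinearMap.ker_eq_bot']
  intro a ha
  by_contra hne
  apply hf
  obtain ⟨r, rfl⟩ := Ideal.Quotient.mk_surjective (I := maximalIdeal R) a
  have hr : IsUnit r := by
    by_contra h
    exact hne (Ideal.Quotient.eq_zero_iff_mem.2 ((mem_maximalIdeal r).2 h))
  ext b
  obtain ⟨u, hu⟩ := hr.exists_right_inv
  obtain ⟨s, rfl⟩ := Ideal.Quotient.mk_surjective (I := maximalIdeal R) b
  have : (Ideal.Quotient.mk (maximalIdeal R) s : kap R) = (s * u) • (Ideal.Quotient.mk (maximalIdeal R) r : kap R) := by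
    change _ = Ideal.Quotient.mk (maximalIdeal R) (s * u * r)
    rw [mul_assoc, mul_comm u, hu, mul_one]
  exact (congrArg f.hom this).trans ((map_smul f.hom _ _).trans ((congrArg ((s * u) • ·) ha).trans (smul_zero _)))

theorem kap_ext_smul {x : R} (hx : x ∈ maximalIdeal R) {N : ModuleCat.{0} R} {i : ℕ} (e : Ext.{0} (kap R) N i) :
    x • e = 0 := by
  rw [ext_smul_pre, show x • 𝟙 (kap R) = 0 from ?_, Ext.mk₀_zero, Ext.zero_comp]
  exact ModuleCat.hom_ext (LinearMap.ext fun a => kap_smul hx a)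

variable [IsNoetherianRing R] {W : ModuleCat.{0} R} [Module.Finite R W] {d : ℕ}

instance quot_fin (N : ModuleCat.{0} R) [Module.Finite R N] (x : R) :
    Module.Finite R (ModuleCat.of R (QuotSMulTop x N)) :=
  inferInstanceAs (Module.Finite R (QuotSMulTop x N))

theorem detect (hk : ∀ i, d < i → Subsingleton (Ext.{0} (kap R) W i)) (hd : Nontrivial (Ext.{0} (kap R) W d))
    (t : ℕ) (N : ModuleCat.{0} R) [hNf : Module.Finite R N] (hN : DepthGE t N) (e : Ext.{0} (kap R) N t) (he : e ≠ 0)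
    (s : ℕ) (hs : t + s = d) : ∃ φ : Ext.{0} N W s, e.comp φ hs ≠ 0 := by
  induction t generalizing N s with
  | zero =>
    obtain rfl : s = d := by omega
    obtain ⟨e, rfl⟩ := (Ext.mk₀_bijective _ _).2 e
    have hinj := kap_inj e (by rintro rfl; exact he (Ext.mk₀_zero _ _))
    obtain ⟨ε, hε⟩ := exists_ne (0 : Ext.{0} (kap R) W s)
    have : Module.Finite R (ModuleCat.of R (N ⧸ LinearMap.range e.hom)) :=
      inferInstanceAs (Module.Finite R (N ⧸ LinearMap.range e.hom))
    have := top_vanish W s hk (ModuleCat.of R (N ⧸ LinearMap.range e.hom)) (s+1) (by omega)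
    obtain ⟨φ, hφ⟩ := Ext.contravariant_sequence_exact₁ (ses_of_inj e hinj) W ε (add_comm 1 s) (this.elim _ _)
    exact ⟨φ, by rw [hφ]; exact hε⟩
  | succ t ih =>
    obtain ⟨x, hx, hr⟩ := hN.exists_regular
    have hS := reg_ses hr
    obtain ⟨e', rfl⟩ := Ext.covariant_sequence_exact₁ (kap R) hS e
      ((ext_smul_post (Y := N) x e).symm.trans (kap_ext_smul hx e)) rfl
    obtain ⟨φ', hφ'⟩ := ih (ModuleCat.of R (QuotSMulTop x N)) (hN.quot hr) e'
      (by rintro rfl; exact he (Ext.zero_comp _ _ _ _ _)) (s+1) (by omega)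
    have := ischebeck W d hk (t+1) N hN (s+1) (by omega)
    obtain ⟨φ, rfl⟩ := Ext.contravariant_sequence_exact₃ hS W φ' (this.elim _ _) (add_comm 1 s)
    refine ⟨φ, ?_⟩
    rw [← Ext.comp_assoc (h₁₂ := rfl) (h₂₃ := add_comm 1 s) (h := by omega)] at hφ'
    exact hφ'

theorem end_scalar {E : Type} [AddCommGroup E] [Module R E] (eq : E ≃ₗ[R] ResidueField R) (ψ : E →ₗ[R] E) :
    ∃ r : R, ∀ φ, ψ φ = r • φ := by
  have key : ∀ φ : E, ∃ a : R, φ = a • eq.symm 1 := by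
    intro φ
    obtain ⟨a, ha⟩ := Ideal.Quotient.mk_surjective (I := maximalIdeal R) (eq φ)
    refine ⟨a, ?_⟩
    rw [← map_smul, LinearEquiv.eq_symm_apply, ← ha, Algebra.smul_def, mul_one]
    rfl
  obtain ⟨r, hr⟩ := key (ψ (eq.symm 1))
  refine ⟨r, fun φ => ?_⟩
  obtain ⟨a, rfl⟩ := key φ
  rw [map_smul, hr, smul_comm]

/-- The vector space case. -/
theorem surj_vec (eq : Ext.{0} (kap R) W d ≃ₗ[R] ResidueField R) (N : Type) [AddCommGroup N] [Module R N]
    [Module.Finite R N] (h : ∀ x ∈ maximalIdeal R, ∀ n : N, x • n = 0)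
    (ψ : Ext.{0} (ModuleCat.of R N) W d →ₗ[R] Ext.{0} (kap R) W d) :
    ∃ f : kap R ⟶ ModuleCat.of R N, ∀ φ, ψ φ = (Ext.mk₀ f).comp φ (zero_add d) := by
  have ht : Module.IsTorsionBySet R N (maximalIdeal R : Set R) := fun n x => h x x.2 n
  letI : Module (ResidueField R) N := ht.module
  haveI : IsScalarTower R (ResidueField R) N := ht.isScalarTower
  haveI : Module.Finite (ResidueField R) N := Module.Finite.of_restrictScalars_finite R _ _
  let b := Module.finBasis (ResidueField R) N
  let inc : Fin _ → (kap R ⟶ ModuleCat.of R N) := fun j =>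
    ModuleCat.ofHom ((LinearMap.toSpanSingleton (ResidueField R) N (b j)).restrictScalars R)
  let pr : Fin _ → (ModuleCat.of R N ⟶ kap R) := fun j => ModuleCat.ofHom ((b.coord j).restrictScalars R)
  have hid : 𝟙 (ModuleCat.of R N) = ∑ j, pr j ≫ inc j := by
    refine ModuleCat.hom_ext (LinearMap.ext fun (n : N) => ?_)
    rw [ModuleCat.hom_sum]
    erw [LinearMap.sum_apply]
    exact (b.sum_repr n).symm
  choose r hr using fun j => end_scalar eq (ψ ∘ₗ (Ext.mk₀ (pr j)).precompOfLinear R W (zero_add d))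
  refine ⟨∑ j, r j • inc j, fun φ => ?_⟩
  conv_lhs => rw [← Ext.mk₀_id_comp φ, hid, Ext.mk₀_sum, Ext.sum_comp, map_sum]
  rw [Ext.mk₀_sum, Ext.sum_comp]
  refine Finset.sum_congr rfl fun j _ => ?_
  rw [← Ext.mk₀_comp_mk₀, Ext.comp_assoc_of_second_deg_zero, Ext.mk₀_smul, Ext.smul_comp]
  exact hr j _

/-- Factor a linear map through a surjection. -/
theorem factor_surj {A B C : Type} [AddCommGroup A] [Module R A] [AddCommGroup B] [Module R B]
    [AddCommGroup C] [Module R C] (p : A →ₗ[R] B) (hp : Function.Surjective p) (ψ : A →ₗ[R] C)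
    (h : ∀ a, p a = 0 → ψ a = 0) : ∃ ψ' : B →ₗ[R] C, ∀ a, ψ' (p a) = ψ a := by
  refine ⟨(LinearMap.ker p).liftQ ψ (fun a ha => h a ha) ∘ₗ (p.quotKerEquivOfSurjective hp).symm.toLinearMap,
    fun a => ?_⟩
  have : (p.quotKerEquivOfSurjective hp).symm (p a) = Submodule.Quotient.mk a := by
    rw [LinearEquiv.symm_apply_eq]; rfl
  rw [LinearMap.comp_apply, LinearEquiv.coe_coe, this]
  exact Submodule.liftQ_apply _ _ _

set_option maxHeartbeats 1000000 in
theorem surj_zero_aux (hk : ∀ i, d < i → Subsingleton (Ext.{0} (kap R) W i))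
    (eq : Ext.{0} (kap R) W d ≃ₗ[R] ResidueField R) (I : Ideal R) : 
    ∀ (N : Type) [AddCommGroup N] [Module R N] (_ : Module.Finite R N) (_ : Module.annihilator R N = I)
      (ψ : Ext.{0} (ModuleCat.of R N) W d →ₗ[R] Ext.{0} (kap R) W d),
    ∃ f : kap R ⟶ ModuleCat.of R N, ∀ φ, ψ φ = (Ext.mk₀ f).comp φ (zero_add d) := by
  induction I using WellFoundedGT.induction with
  | ind I ih =>
  intro N _ _ hN hI ψ
  by_cases hm : ∀ x ∈ maximalIdeal R, ∀ n : N, x • n = 0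
  · exact surj_vec eq N hm ψ
  push Not at hm
  obtain ⟨x, hx, n₀, hn₀⟩ := hm
  let μ : N →ₗ[R] N := LinearMap.lsmul R N x
  let K := LinearMap.ker μ
  let ι : ModuleCat.of R K ⟶ ModuleCat.of R N := ModuleCat.ofHom K.subtype
  have hι : Function.Injective ι.hom := Subtype.val_injective
  have hS := ses_of_inj ι hι
  have hrange : LinearMap.range ι.hom = K := K.range_subtype
  have hfin : Module.Finite R (ModuleCat.of R (N ⧸ LinearMap.range ι.hom)) :=
      inferInstanceAs (Module.Finite R (N ⧸ LinearMap.range ι.hom))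
  let j : ModuleCat.of R (N ⧸ LinearMap.range ι.hom) ⟶ ModuleCat.of R N :=
    ModuleCat.ofHom ((LinearMap.range ι.hom).liftQ μ hrange.le)
  have hj : Function.Injective j.hom := by
    rw [← LinearMap.ker_eq_bot]
    exact Submodule.ker_liftQ_eq_bot _ _ _ hrange.ge
  have hS' := ses_of_inj j hj
  have hcomp : (ModuleCat.ofHom (LinearMap.range ι.hom).mkQ : ModuleCat.of R N ⟶ _) ≫ j = x • 𝟙 (ModuleCat.of R N) := by
    ext n; rfl
  have hsurj : Function.Surjective ((Ext.mk₀ ι).precompOfLinear R W (zero_add d)) := by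
    intro φ
    have := top_vanish W d hk (ModuleCat.of R (N ⧸ LinearMap.range ι.hom)) (d+1) (by omega)
    obtain ⟨φ, hφ⟩ := Ext.contravariant_sequence_exact₁ hS W φ (add_comm 1 d) (this.elim _ _)
    exact ⟨φ, hφ⟩
  obtain ⟨ψ', hψ'⟩ := factor_surj _ hsurj ψ (by
    intro φ hφ
    obtain ⟨φ', rfl⟩ := Ext.contravariant_sequence_exact₂ hS W φ hφ
    have hfin' : Module.Finite R (ModuleCat.of R (N ⧸ LinearMap.range j.hom)) :=
      inferInstanceAs (Module.Finite R (N ⧸ LinearMap.range j.hom))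
    have := top_vanish W d hk (ModuleCat.of R (N ⧸ LinearMap.range j.hom)) (d+1) (by omega)
    obtain ⟨φ, rfl⟩ := Ext.contravariant_sequence_exact₁ hS' W φ' (add_comm 1 d) (this.elim _ _)
    have h2 : (Ext.mk₀ (ModuleCat.ofHom (LinearMap.range ι.hom).mkQ : ModuleCat.of R N ⟶ _)).comp
      ((Ext.mk₀ j).comp φ (zero_add d)) (zero_add d) = x • φ := by
      rw [← Ext.comp_assoc_of_second_deg_zero, Ext.mk₀_comp_mk₀, hcomp, ext_smul_pre]
    refine (congrArg ψ h2).trans ?_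
    rw [map_smul, kap_ext_smul hx])
  obtain ⟨f, hf⟩ := ih (Module.annihilator R K) (by
    refine lt_of_le_of_ne ?_ ?_
    · rw [← hI]; exact LinearMap.annihilator_le_of_injective K.subtype Subtype.val_injective
    · intro h
      have : x ∈ Module.annihilator R K := Module.mem_annihilator.2 fun n => Subtype.ext n.2
      rw [← h, ← hI, Module.mem_annihilator] at this
      exact hn₀ (this n₀)) K inferInstance rfl ψ'
  refine ⟨f ≫ ι, fun φ => ?_⟩
  rw [← hψ', hf, ← Ext.mk₀_comp_mk₀, Ext.comp_assoc_of_second_deg_zero]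
  rfl

theorem surj_claim (hk : ∀ i, d < i → Subsingleton (Ext.{0} (kap R) W i))
    (eq : Ext.{0} (kap R) W d ≃ₗ[R] ResidueField R)
    (t : ℕ) (N : ModuleCat.{0} R) [hNf : Module.Finite R N] (hN : DepthGE t N) 
    (s : ℕ) (hs : t + s = d) (ψ : Ext.{0} N W s →ₗ[R] Ext.{0} (kap R) W d) :
    ∃ e : Ext.{0} (kap R) N t, ∀ φ, ψ φ = e.comp φ hs := by
  induction t generalizing N s with
  | zero =>
    obtain rfl : s = d := by omega
    obtain ⟨f, hf⟩ := surj_zero_aux hk eq _ N hNf rfl ψ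
    exact ⟨Ext.mk₀ f, hf⟩
  | succ t ih =>
    obtain ⟨x, hx, hr⟩ := hN.exists_regular
    have hS := reg_ses hr
    have := ischebeck W d hk (t+1) N hN (s+1) (by omega)
    obtain ⟨ψ', hψ'⟩ := factor_surj (hS.extClass.precompOfLinear R W (add_comm 1 s)) (by
      intro φ'
      obtain ⟨φ, rfl⟩ := Ext.contravariant_sequence_exact₃ hS W φ' (this.elim _ _) (add_comm 1 s)
      exact ⟨φ, rfl⟩) ψ (by
      intro φ hφ
      obtain ⟨φ', rfl⟩ := Ext.contravariant_sequence_exact₁ hS W φ (add_comm 1 s) hφ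
      dsimp only at φ' ⊢
      rw [← ext_smul_pre]
      rw [map_smul, kap_ext_smul hx])
    obtain ⟨e', he'⟩ := ih (ModuleCat.of R (QuotSMulTop x N)) (hN.quot hr) (s+1) (by omega) ψ'
    refine ⟨e'.comp hS.extClass rfl, fun φ => ?_⟩
    rw [← hψ', he']
    exact (Ext.comp_assoc e' hS.extClass φ rfl (add_comm 1 s) (by omega)).symm
end Detect

open CategoryTheory Opposite IsLocalRing

section Bidual
open Abelian
variable {R : Type} [CommRing R] [IsLocalRing R] [IsNoetherianRing R]

theorem exists_socle {K : Type} [AddCommGroup K] [Module R K] [Nontrivial K]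
    (h : Module.supportDim R K ≤ 0) : ∃ e : kap R ⟶ ModuleCat.of R K, e ≠ 0 := by
  have h0 : Module.supportDim R K = 0 := by
    refine le_antisymm h ?_
    exact Order.krullDim_nonneg_iff.2 (Set.Nonempty.to_subtype (Module.nonempty_support_of_nontrivial))
  obtain ⟨P, hP⟩ := associatedPrimes.nonempty R K
  obtain ⟨hPp, y, hy⟩ := (isAssociatedPrime_iff (R := R) (M := K)).1 hP
  have hmem : (⟨P, hPp⟩ : PrimeSpectrum R) ∈ Module.support R K := by
    rw [Module.mem_support_iff_exists_annihilator]
    refine ⟨y, ?_⟩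
    intro r hr
    rw [Submodule.mem_annihilator_span_singleton] at hr
    change r ∈ P
    rw [hy, Submodule.mem_colon_singleton, hr]
    exact Submodule.zero_mem _
  rw [support_of_supportDim_eq_zero R K h0] at hmem
  have hmP : maximalIdeal R ≤ P := hmem
  have hk : ∀ x ∈ maximalIdeal R, x • y = 0 := by
    intro x hx
    have := hmP hx
    rw [hy, Submodule.mem_colon_singleton] at this
    exact (Submodule.mem_bot R).1 this
  have hy0 : y ≠ 0 := by
    rintro rfl
    apply hPp.ne_top
    rw [hy, Ideal.eq_top_iff_one, Submodule.mem_colon_singleton]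
    simp
  refine ⟨ModuleCat.ofHom ((maximalIdeal R).liftQ (LinearMap.toSpanSingleton R K y) (fun x hx => hk x hx)), ?_⟩
  intro hz
  apply hy0
  have := LinearMap.congr_fun (congrArg ModuleCat.Hom.hom hz) (Ideal.Quotient.mk (maximalIdeal R) 1 : kap R)
  have h2 : (1 : R) • y = 0 := this
  rwa [one_smul] at h2

theorem wb_le {a : WithBot ℕ∞} {t : ℕ} (h : a + 1 ≤ ((t + 1 : ℕ) : WithBot ℕ∞)) : a ≤ (t : WithBot ℕ∞) := by
  induction a using WithBot.recBotCoe with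
  | bot => exact bot_le
  | coe a =>
    have h' : a + 1 ≤ ((t + 1 : ℕ) : ℕ∞) := WithBot.coe_le_coe.1 h
    refine WithBot.coe_le_coe.2 (?_ : a ≤ (t : ℕ∞))
    rw [Nat.cast_add, Nat.cast_one] at h'
    exact (ENat.add_le_add_iff_right (by simp)).1 h'

theorem inj_criterion (t : ℕ) {N N' : ModuleCat.{0} R} [Module.Finite R N] [Module.Finite R N'] (f : N ⟶ N')
    (hdim : Module.supportDim R N ≤ t) (hN : DepthGE t N) (hN' : DepthGE t N')
    (h : ∀ e : Ext.{0} (kap R) N t, e.comp (Ext.mk₀ f) (add_zero t) = 0 → e = 0) :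
    Function.Injective f.hom := by
  induction t generalizing N N' with
  | zero =>
    rw [← LinearMap.ker_eq_bot]
    by_contra hne
    have : Nontrivial (LinearMap.ker f.hom) := Submodule.nontrivial_iff_ne_bot.2 hne
    obtain ⟨e, he⟩ := exists_socle (R := R) (K := LinearMap.ker f.hom)
      ((Module.supportDim_le_of_injective (LinearMap.ker f.hom).subtype Subtype.val_injective).trans hdim)
    apply he
    have h1 := h (Ext.mk₀ (e ≫ ModuleCat.ofHom (LinearMap.ker f.hom).subtype)) (by
      rw [Ext.mk₀_comp_mk₀, Ext.mk₀_eq_zero_iff]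
      exact ModuleCat.hom_ext (LinearMap.ext fun x => (e.hom x).2))
    rw [Ext.mk₀_eq_zero_iff] at h1
    exact ModuleCat.hom_ext (LinearMap.ext fun x =>
      Subtype.ext (LinearMap.congr_fun (congrArg ModuleCat.Hom.hom h1) x))
  | succ t ih =>
    obtain ⟨x, hx, hr⟩ : ∃ x ∈ maximalIdeal R, IsSMulRegular (N × N') x := by
      have : Module.Finite R (ModuleCat.of R (N × N')) := inferInstanceAs (Module.Finite R (N × N'))
      refine DepthGE.exists_regular (t := 0) (N := ModuleCat.of R (N × N')) ?_
      intro j hj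
      obtain rfl : j = 0 := by omega
      refine subsingleton_of_forall_eq 0 fun e => ?_
      obtain ⟨e, rfl⟩ := (Ext.mk₀_bijective _ _).2 e
      rw [Ext.mk₀_eq_zero_iff]
      have h1 := (hN 0 (by omega)).elim (Ext.mk₀ (e ≫ ModuleCat.ofHom (LinearMap.fst R N N'))) 0
      have h2 := (hN' 0 (by omega)).elim (Ext.mk₀ (e ≫ ModuleCat.ofHom (LinearMap.snd R N N'))) 0
      rw [Ext.mk₀_eq_zero_iff] at h1 h2
      exact ModuleCat.hom_ext (LinearMap.ext fun x => Prod.ext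
        (LinearMap.congr_fun (congrArg ModuleCat.Hom.hom h1) x)
        (LinearMap.congr_fun (congrArg ModuleCat.Hom.hom h2) x))
    have hr1 : IsSMulRegular N x := fun a b hab => by
      have : x • ((a, 0) : N × N') = x • (b, 0) := Prod.ext hab rfl
      exact congrArg Prod.fst (hr this)
    have hr2 : IsSMulRegular N' x := fun a b hab => by
      have : x • ((0, a) : N × N') = x • (0, b) := Prod.ext rfl hab
      exact congrArg Prod.snd (hr this)
    have hS1 := reg_ses hr1
    have hS2 := reg_ses hr2
    let fb : ModuleCat.of R (QuotSMulTop x N) ⟶ ModuleCat.of R (QuotSMulTop x N') :=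
      ModuleCat.ofHom (QuotSMulTop.map x f.hom)
    have hfb : Function.Injective fb.hom := by
      refine ih fb ?_ (hN.quot hr1) (hN'.quot hr2) ?_
      · have := Module.supportDim_quotSMulTop_succ_eq_supportDim hr1 hx
        rw [← this] at hdim
        exact wb_le hdim
      · intro e he
        have hnat := ShortComplex.ShortExact.extClass_naturality hS1 hS2
          { τ₁ := f, τ₂ := f, τ₃ := fb,
            comm₁₂ := by simp
            comm₂₃ := rfl }
        have h1 : e.comp hS1.extClass rfl = 0 := by
          apply h
          rw [Ext.comp_assoc_of_third_deg_zero]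
          refine (congrArg (fun z => e.comp z rfl) hnat).trans ?_
          rw [← Ext.comp_assoc_of_second_deg_zero]
          rw [he, Ext.zero_comp]
        obtain ⟨y, rfl⟩ := Ext.covariant_sequence_exact₃ (kap R) hS1 e rfl h1
        rw [(hN t (by omega)).elim y 0, Ext.zero_comp]
    have : Subsingleton (LinearMap.ker f.hom) := by
      refine sub_of_smul_surj (R := R) hx ?_
      rintro ⟨n, hn⟩
      have h1 : fb.hom (Submodule.Quotient.mk n : QuotSMulTop x N) = 0 := by
        change (Submodule.Quotient.mk (f.hom n) : QuotSMulTop x N') = 0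
        rw [LinearMap.mem_ker.1 hn]; rfl
      have h2 := hfb (h1.trans (map_zero fb.hom).symm)
      obtain ⟨n', -, hn'⟩ := (Submodule.Quotient.mk_eq_zero _).1 h2
      have hn' : x • n' = n := hn'
      refine ⟨⟨n', ?_⟩, Subtype.ext hn'⟩
      rw [LinearMap.mem_ker]
      apply hr2
      change x • f.hom n' = x • 0
      rw [← map_smul, hn', LinearMap.mem_ker.1 hn, smul_zero]
    rw [← LinearMap.ker_eq_bot]
    exact (Submodule.subsingleton_iff_eq_bot).1 this

theorem sub_of_no_map {Q : Type} [AddCommGroup Q] [Module R Q] [Module.Finite R Q]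
    (h : ∀ ψ : Q →ₗ[R] ResidueField R, ψ = 0) : Subsingleton Q := by
  by_contra hne
  rw [not_subsingleton_iff_nontrivial] at hne
  obtain ⟨P, hP, -⟩ := (eq_top_or_exists_le_coatom (⊥ : Submodule R Q)).resolve_left bot_ne_top
  have hs := isSimpleModule_iff_isCoatom.2 hP
  obtain ⟨I, hI, ⟨e⟩⟩ := isSimpleModule_iff_quot_maximal.1 hs
  obtain rfl := IsLocalRing.eq_maximalIdeal hI
  have h1 := h (e.toLinearMap ∘ₗ P.mkQ)
  apply hP.1
  rw [eq_top_iff]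
  intro q _
  have := LinearMap.congr_fun h1 q
  have h2 : e (P.mkQ q) = 0 := this
  rw [e.map_eq_zero_iff] at h2
  exact (Submodule.Quotient.mk_eq_zero _).1 h2
end Bidual

open CategoryTheory Opposite IsLocalRing

section Bidual2
open Abelian
variable {R : Type} [CommRing R] [IsLocalRing R] [IsNoetherianRing R]
  {W : ModuleCat.{0} R} [Module.Finite R W] {d : ℕ}

theorem GG_of_depth (hk : ∀ i, d < i → Subsingleton (Ext.{0} (kap R) W i)) {N : ModuleCat.{0} R}
    [Module.Finite R N] (hN : DepthGE d N) : GG W N := fun i hi =>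
  ischebeck W d hk d N hN i (by omega)

/-- `Hom(N,W)` as a linear equivalence to `Ext⁰`. -/
noncomputable def hom0 (N W : ModuleCat.{0} R) : (N →ₗ[R] W) ≃ₗ[R] Ext.{0} N W 0 :=
  (ModuleCat.homLinearEquiv (S := R) (M := N) (N := W)).symm ≪≫ₗ (Ext.linearEquiv₀ (R := R) (X := N) (Y := W)).symm

theorem hom0_apply {N W : ModuleCat.{0} R} (φ : N →ₗ[R] W) : hom0 N W φ = Ext.mk₀ (ModuleCat.ofHom φ) := rfl

theorem T_inj (hk : ∀ i, d < i → Subsingleton (Ext.{0} (kap R) W i)) (hd : Nontrivial (Ext.{0} (kap R) W d))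
    {N : ModuleCat.{0} R} [Module.Finite R N] (hN : DepthGE d N) (e : Ext.{0} (kap R) N d)
    (he : e.comp (Ext.mk₀ (theta W N)) (add_zero d) = 0) : e = 0 := by
  by_contra hne
  obtain ⟨φ, hφ⟩ := detect hk hd d N hN e hne 0 (add_zero d)
  obtain ⟨φ, rfl⟩ := (hom0 N W).surjective φ
  apply hφ
  rw [hom0_apply, ← theta_ev, ← Ext.mk₀_comp_mk₀, ← Ext.comp_assoc_of_third_deg_zero, he, Ext.zero_comp]

theorem T_surj (hk : ∀ i, i ≠ d → Subsingleton (Ext.{0} (kap R) W i))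
    (eq : Ext.{0} (kap R) W d ≃ₗ[R] ResidueField R)
    {N : ModuleCat.{0} R} [Module.Finite R N] (hN : DepthGE d N) (e : Ext.{0} (kap R) (DD W (DD W N)) d) :
    ∃ e₀ : Ext.{0} (kap R) N d, e₀.comp (Ext.mk₀ (theta W N)) (add_zero d) = e := by
  have hk1 : ∀ i, d < i → Subsingleton (Ext.{0} (kap R) W i) := fun i hi => hk i (by omega)
  have hk2 : ∀ i, i < d → Subsingleton (Ext.{0} (kap R) W i) := fun i hi => hk i (by omega)
  have hN1 : DepthGE d (DD W N) := GG.depth hk2 N (GG_of_depth hk1 hN)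
  obtain ⟨e₀, he₀⟩ := surj_claim hk1 eq d N hN 0 (add_zero d)
    ((e.precompOfLinear R W (add_zero d)) ∘ₗ (hom0 (DD W (DD W N)) W).toLinearMap ∘ₗ
      (theta W (DD W N)).hom ∘ₗ (hom0 N W).symm.toLinearMap)
  refine ⟨e₀, ?_⟩
  rw [← sub_eq_zero]
  refine dual_detect W hk2 d le_rfl (DD W N) (GG_of_depth hk1 hN1) _ fun (φ : N →ₗ[R] W) => ?_
  have h1 := he₀ (hom0 N W φ)
  have h2 : e.comp (Ext.mk₀ (evm W (M := DD W N) φ)) (add_zero d) = e₀.comp (hom0 N W φ) (add_zero d) := by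
    refine Eq.trans ?_ h1
    simp only [LinearMap.comp_apply, LinearEquiv.coe_coe, LinearEquiv.symm_apply_apply]
    rfl
  rw [sub_eq_add_neg, Ext.add_comp, Ext.neg_comp, h2, hom0_apply, ← theta_ev, ← Ext.mk₀_comp_mk₀,
    ← Ext.comp_assoc_of_third_deg_zero, add_neg_cancel]

theorem dual_theta_inj (hk : ∀ i, i ≠ d → Subsingleton (Ext.{0} (kap R) W i))
    (eq : Ext.{0} (kap R) W d ≃ₗ[R] ResidueField R)
    {N : ModuleCat.{0} R} [Module.Finite R N] (hN : DepthGE d N) :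
    Function.Injective (DM W (theta W N)).hom := by
  have hk1 : ∀ i, d < i → Subsingleton (Ext.{0} (kap R) W i) := fun i hi => hk i (by omega)
  have hk2 : ∀ i, i < d → Subsingleton (Ext.{0} (kap R) W i) := fun i hi => hk i (by omega)
  have hN1 : DepthGE d (DD W N) := GG.depth hk2 N (GG_of_depth hk1 hN)
  have hN2 : DepthGE d (DD W (DD W N)) := GG.depth hk2 _ (GG_of_depth hk1 hN1)
  let p : DD W (DD W (DD W N)) →ₗ[R] DD W N := (DM W (theta W N)).hom
  let s : DD W N →ₗ[R] DD W (DD W (DD W N)) := (theta W (DD W N)).hom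
  have hps : ∀ z, p (s z) = z := fun z => rfl
  let Q := LinearMap.ker p
  let π : DD W (DD W (DD W N)) →ₗ[R] Q := (LinearMap.id - s ∘ₗ p).codRestrict Q (fun z => by
    rw [LinearMap.mem_ker, LinearMap.sub_apply, map_sub]
    change p z - p (s (p z)) = 0
    rw [hps, sub_self])
  have : Subsingleton Q := by
    refine sub_of_no_map (R := R) fun ψ => LinearMap.ext fun q => ?_
    obtain ⟨e, he⟩ := surj_claim hk1 eq d _ hN2 0 (add_zero d)
      (eq.symm.toLinearMap ∘ₗ ψ ∘ₗ π ∘ₗ (hom0 (DD W (DD W N)) W).symm.toLinearMap)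
    obtain ⟨e₀, rfl⟩ := T_surj hk eq hN e
    have h1 := he (hom0 (DD W (DD W N)) W q.1)
    have hq : π q.1 = q := Subtype.ext (by
      change q.1 - s (p q.1) = q.1
      rw [LinearMap.mem_ker.1 q.2, map_zero, sub_zero])
    simp only [LinearMap.comp_apply, LinearEquiv.coe_coe, LinearEquiv.symm_apply_apply] at h1
    rw [hq, hom0_apply, Ext.comp_assoc_of_third_deg_zero, Ext.mk₀_comp_mk₀] at h1
    have h3 : theta W N ≫ ModuleCat.ofHom q.1 = 0 := by
      exact ModuleCat.hom_ext (LinearMap.mem_ker.1 q.2)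
    rw [h3, Ext.mk₀_zero, Ext.comp_zero] at h1
    rw [LinearMap.zero_apply]
    exact eq.symm.map_eq_zero_iff.1 h1
  rw [← LinearMap.ker_eq_bot]
  exact (Submodule.subsingleton_iff_eq_bot).1 this

theorem theta_bij (hk : ∀ i, i ≠ d → Subsingleton (Ext.{0} (kap R) W i))
    (eq : Ext.{0} (kap R) W d ≃ₗ[R] ResidueField R) (hdim : ringKrullDim R ≤ d)
    {N : ModuleCat.{0} R} [Module.Finite R N] (hN : DepthGE d N) :
    Function.Bijective (theta W N).hom := by
  have hk1 : ∀ i, d < i → Subsingleton (Ext.{0} (kap R) W i) := fun i hi => hk i (by omega)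
  have hk2 : ∀ i, i < d → Subsingleton (Ext.{0} (kap R) W i) := fun i hi => hk i (by omega)
  have hnt : Nontrivial (Ext.{0} (kap R) W d) := eq.toEquiv.nontrivial
  have hN1 : DepthGE d (DD W N) := GG.depth hk2 N (GG_of_depth hk1 hN)
  have hN2 : DepthGE d (DD W (DD W N)) := GG.depth hk2 _ (GG_of_depth hk1 hN1)
  have hinj : Function.Injective (theta W N).hom :=
    inj_criterion d (theta W N) ((Module.supportDim_le_ringKrullDim R N).trans hdim) hN hN2
      (T_inj hk1 hnt hN)
  refine ⟨hinj, ?_⟩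
  have hS := ses_of_inj (theta W N) hinj
  let C : ModuleCat.{0} R := ModuleCat.of R (DD W (DD W N) ⧸ LinearMap.range (theta W N).hom)
  let g : DD W (DD W N) ⟶ C := ModuleCat.ofHom (LinearMap.range (theta W N).hom).mkQ
  have hCf : Module.Finite R C :=
    inferInstanceAs (Module.Finite R (DD W (DD W N) ⧸ LinearMap.range (theta W N).hom))
  have hC : DepthGE d C := by
    intro j hj
    refine subsingleton_of_forall_eq 0 fun e => ?_
    obtain ⟨y, rfl⟩ := Ext.covariant_sequence_exact₃ (kap R) hS e rfl (by
      rcases Nat.lt_or_ge (j+1) d with h | h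
      · exact (hN _ h).elim _ _
      · obtain rfl : d = j + 1 := by omega
        refine T_inj hk1 hnt hN _ ?_
        rw [Ext.comp_assoc_of_third_deg_zero]
        refine (congrArg (fun z => Ext.comp e z rfl) hS.extClass_comp).trans ?_
        exact Ext.comp_zero _ _ _ _ _)
    rw [(hN2 j hj).elim y 0, Ext.zero_comp]
  have hC0 : ∀ φ : C →ₗ[R] W, φ = 0 := by
    intro φ
    have h1 : (DM W (theta W N)).hom (φ ∘ₗ g.hom) = 0 := by
      refine LinearMap.ext fun (n : N) => ?_
      change φ (g.hom ((theta W N).hom n)) = 0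
      have : g.hom ((theta W N).hom n) = 0 := (Submodule.Quotient.mk_eq_zero _).2 ⟨n, rfl⟩
      rw [this, map_zero]
    have h2 : φ ∘ₗ g.hom = 0 := dual_theta_inj hk eq hN (h1.trans (map_zero _).symm)
    refine LinearMap.ext fun c => ?_
    obtain ⟨c, rfl⟩ := Submodule.mkQ_surjective _ c
    exact LinearMap.congr_fun h2 c
  have hCd : ∀ e : Ext.{0} (kap R) C d, e = 0 := by
    intro e
    by_contra hne
    obtain ⟨φ, hφ⟩ := detect hk1 hnt d C hC e hne 0 (add_zero d)
    obtain ⟨φ, rfl⟩ := (hom0 C W).surjective φ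
    apply hφ
    rw [hC0 φ, map_zero, Ext.comp_zero]
  have hCi := inj_criterion d (0 : C ⟶ C) ((Module.supportDim_le_ringKrullDim R C).trans hdim) hC hC
    (fun e _ => hCd e)
  intro z
  have : g.hom z = 0 := hCi rfl
  exact (Submodule.Quotient.mk_eq_zero _).1 this
end Bidual2

open CategoryTheory Opposite IsLocalRing

section Final
open Abelian
variable {R : Type} [CommRing R]

theorem equiv_of_surj {A B A' B' : Type} [AddCommGroup A] [Module R A] [AddCommGroup B] [Module R B]
    [AddCommGroup A'] [Module R A'] [AddCommGroup B'] [Module R B'] (p : A →ₗ[R] B) (hp : Function.Surjective p)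
    (p' : A' →ₗ[R] B') (hp' : Function.Surjective p') (t : A ≃ₗ[R] A') (h : ∀ a, p a = 0 ↔ p' (t a) = 0) :
    Nonempty (B ≃ₗ[R] B') := by
  have hq : (LinearMap.ker p) = LinearMap.ker (p' ∘ₗ t.toLinearMap) := by
    ext a; exact h a
  have hs : Function.Surjective (p' ∘ₗ t.toLinearMap) := hp'.comp t.surjective
  exact ⟨(p.quotKerEquivOfSurjective hp).symm ≪≫ₗ Submodule.quotEquivOfEq _ _ hq ≪≫ₗ
    (p' ∘ₗ t.toLinearMap).quotKerEquivOfSurjective hs⟩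

/-- Duality on homs. -/
def tauL (W M N : ModuleCat.{0} R) : (M →ₗ[R] N) →ₗ[R] (DD W N →ₗ[R] DD W M) where
  toFun f := LinearMap.lcomp R W f
  map_add' f g := LinearMap.ext fun φ => LinearMap.ext fun m => map_add φ _ _
  map_smul' r f := LinearMap.ext fun φ => LinearMap.ext fun m => map_smul φ _ _

theorem tauL_bij {W M N : ModuleCat.{0} R} (h : Function.Bijective (theta W N).hom) :
    Function.Bijective (tauL W M N) := by
  constructor
  · intro f g hfg
    refine LinearMap.ext fun m => h.1 (LinearMap.ext fun (φ : N →ₗ[R] W) => ?_)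
    exact LinearMap.congr_fun (LinearMap.congr_fun hfg φ) m
  · intro k
    let e : N ≃ₗ[R] DD W (DD W N) := LinearEquiv.ofBijective (theta W N).hom h
    let k' : M →ₗ[R] DD W (DD W N) := LinearMap.flip (show (N →ₗ[R] W) →ₗ[R] M →ₗ[R] W from k)
    refine ⟨e.symm.toLinearMap ∘ₗ k', LinearMap.ext fun (φ : N →ₗ[R] W) => LinearMap.ext fun (m : M) => ?_⟩
    have h1 : e (e.symm (k' m)) = k' m := e.apply_symm_apply _
    exact LinearMap.congr_fun h1 φ

variable [IsNoetherianRing R] [IsLocalRing R]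

theorem main_iso (W N : ModuleCat.{0} R) (hb : Function.Bijective (theta W N).hom) (hG : GG W (DD W N)) (i : ℕ)
    (M : ModuleCat.{0} R) [Module.Finite R M] (hM : GG W M) :
    Nonempty (Ext.{0} M N i ≃ₗ[R] Ext.{0} (DD W N) (DD W M) i) := by
  induction i generalizing M with
  | zero =>
    exact ⟨(hom0 M N).symm ≪≫ₗ LinearEquiv.ofBijective _ (tauL_bij hb) ≪≫ₗ hom0 (DD W N) (DD W M)⟩
  | succ i ih =>
    obtain ⟨n, K, f, g, w, hS, hK⟩ := exists_syzygy M
    have : Projective (ShortComplex.mk f g w).X₂ := proj_fin n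
    have hKG : GG W K := GG.syz hS hM
    have hD := dual_shortExact W hS (hM 1 one_pos)
    have hs1 : Function.Surjective (hS.extClass.precompOfLinear R N (add_comm 1 i)) :=
      precomp_extClass_surjective_of_projective_X₂ N hS i
    have hs2 : Function.Surjective (hD.extClass.postcompOfLinear R (DD W N) (rfl : i + 1 = i + 1)) := by
      intro e
      obtain ⟨y, hy⟩ := Ext.covariant_sequence_exact₁ (DD W N) hD e
        ((sub_fdual W (hG (i+1) (by omega))).elim _ _) rfl
      exact ⟨y, hy⟩
    cases i with
    | zero =>
      refine equiv_of_surj _ hs1 _ hs2 ((hom0 K N).symm ≪≫ₗ LinearEquiv.ofBijective _ (tauL_bij hb) ≪≫ₗ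
        hom0 (DD W N) (DD W K)) ?_
      intro a
      obtain ⟨a, rfl⟩ := (hom0 K N).surjective a
      simp only [LinearEquiv.trans_apply, LinearEquiv.symm_apply_apply, LinearEquiv.ofBijective_apply]
      constructor
      · intro h
        obtain ⟨b, hb1⟩ := Ext.contravariant_sequence_exact₁ hS N (hom0 K N a) (add_comm 1 0) h
        obtain ⟨b, rfl⟩ := (Ext.mk₀_bijective _ _).2 b
        rw [Ext.mk₀_comp_mk₀] at hb1
        have hb2 : f ≫ b = ModuleCat.ofHom a := (Ext.mk₀_bijective _ _).1 hb1
        have hb3 : hom0 (DD W N) (DD W K) (tauL W K N a) =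
            (Ext.mk₀ (DM W b)).comp (Ext.mk₀ (DM W f)) (add_zero 0) := by
          rw [Ext.mk₀_comp_mk₀, hom0_apply]
          have : a = (f ≫ b).hom := by rw [hb2]; rfl
          rw [this]; rfl
        refine (congrArg (fun z => Ext.comp z hD.extClass (zero_add 1)) hb3).trans ?_
        refine (Ext.comp_assoc_of_second_deg_zero _ _ _ _).trans ?_
        refine (congrArg (fun z => (Ext.mk₀ (DM W b)).comp z (zero_add 1)) hD.comp_extClass).trans ?_
        exact Ext.comp_zero _ _ _ _ _
      · intro h
        obtain ⟨c, hc⟩ := Ext.covariant_sequence_exact₃ (DD W N) hD (hom0 (DD W N) (DD W K) (tauL W K N a))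
          (zero_add 1) h
        obtain ⟨c, rfl⟩ := (Ext.mk₀_bijective _ _).2 c
        obtain ⟨b, hb1⟩ := (tauL_bij (M := ModuleCat.of R (Fin n → R)) hb).2 c.hom
        rw [Ext.mk₀_comp_mk₀] at hc
        have hc2 : c ≫ DM W f = ModuleCat.ofHom (tauL W K N a) := (Ext.mk₀_bijective _ _).1 hc
        have hc3 : tauL W K N a = tauL W K N (b ∘ₗ f.hom) := by
          have := congrArg ModuleCat.Hom.hom hc2
          refine this.symm.trans ?_
          change (DM W f).hom ∘ₗ c.hom = _
          rw [← hb1]; rfl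
        have hc4 : a = b ∘ₗ f.hom := (tauL_bij hb).1 hc3
        have hc5 : hom0 K N a = (Ext.mk₀ f).comp (Ext.mk₀ (ModuleCat.ofHom b)) (add_zero 0) := by
          rw [Ext.mk₀_comp_mk₀, hc4]; rfl
        refine (congrArg (fun z => Ext.comp hS.extClass z (add_zero 1)) hc5).trans ?_
        refine (Ext.comp_assoc_of_second_deg_zero _ _ _ _).symm.trans ?_
        refine (congrArg (fun z => z.comp (Ext.mk₀ (ModuleCat.ofHom b)) (add_zero 1)) hS.extClass_comp).trans ?_
        exact Ext.zero_comp _ _ _ _ _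
    | succ j =>
      obtain ⟨t⟩ := ih K hKG
      refine equiv_of_surj _ hs1 _ hs2 t ?_
      intro a
      have h1 : ∀ a : Ext.{0} K N (j+1), hS.extClass.comp a (add_comm 1 (j+1)) = 0 → a = 0 := by
        intro a ha
        obtain ⟨y, rfl⟩ := Ext.contravariant_sequence_exact₁ hS N a (add_comm 1 (j+1)) ha
        rw [(sub_proj (X := (ShortComplex.mk f g w).X₂) (Y := N) (j+1) (by omega)).elim y 0, Ext.comp_zero]
      have h2 : ∀ a : Ext.{0} (DD W N) (DD W K) (j+1), a.comp hD.extClass rfl = 0 → a = 0 := by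
        intro a ha
        obtain ⟨y, rfl⟩ := Ext.covariant_sequence_exact₃ (DD W N) hD a rfl ha
        rw [(sub_fdual W (hG (j+1) (by omega))).elim y 0, Ext.zero_comp]
      constructor
      · intro h
        rw [h1 a h, map_zero, map_zero]
      · intro h
        have := h2 _ h
        rw [t.map_eq_zero_iff.1 this, map_zero]
end Final

theorem depthGE_of_MCM {R : Type} [CommRing R] [IsLocalRing R] {N : Type} [AddCommGroup N] [Module R N] {d : ℕ}
    (hd : ringKrullDim R = d) (h : ((moduleDepth R N : ℕ∞) : WithBot ℕ∞) = ringKrullDim R) :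
    DepthGE d (ModuleCat.of R N) := by
  intro j hj
  obtain ⟨e⟩ := ext_comparison (kap R) (ModuleCat.of R N) j
  refine (e.toEquiv.subsingleton_congr).1 ?_
  rw [← not_nontrivial_iff_subsingleton]
  intro hnt
  have h1 : moduleDepth R N ≤ (j : ℕ∞) := sInf_le ⟨j, rfl, hnt⟩
  rw [hd] at h
  have h2 : moduleDepth R N = (d : ℕ∞) := WithBot.coe_injective h
  rw [h2] at h1
  exact absurd (Nat.cast_le.1 h1) (by omega)

/-- Let `R` be a Cohen-Macaulay local ring with canonical module `ω`, and write
`M^∨ = Hom_R(M, ω)`.  Then for any maximal Cohen-Macaulay `R`-modules `M, N` and all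
`i ≥ 0` there is an isomorphism `Ext_R^i(M, N) ≅ Ext_R^i(N^∨, M^∨)`. -/
theorem ext_iso_ext_dual
    (R : Type) [CommRing R] [IsLocalRing R] (hCM : IsCohenMacaulayLocalRing R)
    (ω : Type) [AddCommGroup ω] [Module R ω] (hω : IsCanonicalModule R ω)
    (M N : Type) [AddCommGroup M] [Module R M] [AddCommGroup N] [Module R N]
    (hM : IsMCM R M) (hN : IsMCM R N) (i : ℕ) :
    Nonempty (ExtGroup R i M N ≃ₗ[R] ExtGroup R i (N →ₗ[R] ω) (M →ₗ[R] ω)) := by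
  haveI : IsNoetherianRing R := hCM.1
  obtain ⟨hWf, hW1, hW2⟩ := hω
  obtain ⟨d, hd⟩ : ∃ d : ℕ, ringKrullDim R = d := by
    obtain ⟨n, hn⟩ := WithBot.ne_bot_iff_exists.1 (ringKrullDim_ne_bot (R := R))
    obtain ⟨m, hm⟩ := ENat.ne_top_iff_exists.1 (show n ≠ ⊤ from by
      rintro rfl
      exact ringKrullDim_ne_top (R := R) hn.symm)
    exact ⟨m, by rw [← hn, ← hm]; rfl⟩
  have hMf : Module.Finite R (ModuleCat.of R M) := hM.1
  have hNf : Module.Finite R (ModuleCat.of R N) := hN.1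
  have hWf' : Module.Finite R (ModuleCat.of R ω) := hWf
  have hk : ∀ i, i ≠ d → Subsingleton (Abelian.Ext.{0} (kap R) (ModuleCat.of R ω) i) := by
    intro i hi
    obtain ⟨e⟩ := ext_comparison (kap R) (ModuleCat.of R ω) i
    refine (e.toEquiv.subsingleton_congr).1 (hW1 i ?_)
    rw [hd]
    intro h
    exact hi (Nat.cast_injective (R := ℕ∞) (WithBot.coe_injective h))
  obtain ⟨eq⟩ : Nonempty (Abelian.Ext.{0} (kap R) (ModuleCat.of R ω) d ≃ₗ[R] ResidueField R) := by
    obtain ⟨e⟩ := ext_comparison (kap R) (ModuleCat.of R ω) d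
    obtain ⟨e'⟩ := hW2 d hd.symm
    exact ⟨e.symm ≪≫ₗ e'⟩
  have hk1 : ∀ i, d < i → Subsingleton (Abelian.Ext.{0} (kap R) (ModuleCat.of R ω) i) :=
    fun i hi => hk i (by omega)
  have hk2 : ∀ i, i < d → Subsingleton (Abelian.Ext.{0} (kap R) (ModuleCat.of R ω) i) :=
    fun i hi => hk i (by omega)
  have hMd := depthGE_of_MCM hd hM.2
  have hNd := depthGE_of_MCM hd hN.2
  have hN1 : DepthGE d (DD (ModuleCat.of R ω) (ModuleCat.of R N)) := GG.depth hk2 _ (GG_of_depth hk1 hNd)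
  obtain ⟨e⟩ := main_iso (ModuleCat.of R ω) (ModuleCat.of R N) (theta_bij hk eq hd.le hNd)
    (GG_of_depth hk1 hN1) i (ModuleCat.of R M) (GG_of_depth hk1 hMd)
  obtain ⟨e1⟩ := ext_comparison (ModuleCat.of R M) (ModuleCat.of R N) i
  obtain ⟨e2⟩ := ext_comparison (ModuleCat.of R (N →ₗ[R] ω)) (ModuleCat.of R (M →ₗ[R] ω)) i
  exact ⟨e1 ≪≫ₗ e ≪≫ₗ e2.symm⟩
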